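/- For every integer n ≥ 1, Σ_{T ∈ Tab_n} 2^{fr(T)} = Σ_{f ∈ SP_n} 2^{ndf(f)}, where the left sum ranges over all tableaux in Tab_n and the right sum over all surjective pistols of size n. -/

import Mathlib

/-- A tableau in `Tab_n`. -/
def IsTab (n : ℕ) (T : Finset (ℕ × ℕ)) : Prop :=
  (∀ d ∈ T, 1 ≤ d.1 ∧ d.1 ≤ n ∧ 1 ≤ d.2 ∧ d.2 ≤ 2 * n) ∧
  (∀ i, 1 ≤ i → i ≤ 2 * n → (T.filter (fun d => d.2 = i)).card = 1) ∧
  (∀ j, 1 ≤ j → j ≤ n → (T.filter (fun d => d.1 = j)).card = 2) ∧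
  (∀ d ∈ T, d.1 ≤ d.2)

/-- The set `Tab_n`. -/
def Tab (n : ℕ) : Set (Finset (ℕ × ℕ)) := {T | IsTab n T}

/-- The number of free dots of `T`, i.e. dots `(j, p)` with `p ≥ 2n + 1 - j`. -/
def fr (n : ℕ) (T : Finset (ℕ × ℕ)) : ℕ :=
  (T.filter (fun d => 2 * n + 1 ≤ d.1 + d.2)).card

/-- A surjective pistol of size `n`, encoded as a function `ℕ → ℕ` vanishing
outside `[1, 2n]`. -/
def IsSP (n : ℕ) (f : ℕ → ℕ) : Prop :=
  (∀ j, 1 ≤ j → j ≤ 2 * n → Even (f j) ∧ 2 ≤ f j ∧ f j ≤ 2 * n ∧ j ≤ f j) ∧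
  (∀ v, Even v → 2 ≤ v → v ≤ 2 * n → ∃ j, 1 ≤ j ∧ j ≤ 2 * n ∧ f j = v) ∧
  (∀ j, j = 0 ∨ 2 * n < j → f j = 0)

/-- The set `SP_n` of surjective pistols of size `n`. -/
def SP (n : ℕ) : Set (ℕ → ℕ) := {f | IsSP n f}

/-- `j` is a doubled fixed point of `f`. -/
def IsDFP (f : ℕ → ℕ) (j : ℕ) : Prop := f j = j ∧ ∃ j' < j, f j' = j

/-- `ndf(f)`: the number of elements of `{2, 4, …, 2n}` that are not doubled fixed
points of `f`. -/
noncomputable def ndf (n : ℕ) (f : ℕ → ℕ) : ℕ :=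
  {i : ℕ | 1 ≤ i ∧ i ≤ n ∧ ¬ (i < n ∧ IsDFP f (2 * i))}.ncard

open Equiv

/-- Expansion of a permanent along a row which is the indicator of a set `X` of columns on which
all other rows are constant. -/
theorem sum_perm_option {α : Type*} [Fintype α] [DecidableEq α] (X : Option α → Prop)
    [DecidablePred X] (A : α → Option α → ℕ)
    (hA : ∀ a x, X x → A a x = A a none) :
    ∑ σ : Perm (Option α), (if X (σ none) then ∏ a, A a (σ (some a)) else 0) =
      Fintype.card {x // X x} * ∑ τ : Perm α, ∏ a, A a (some (τ a)) := by
  rw [← Perm.decomposeOption.symm.sum_comp, Fintype.sum_prod_type, Fintype.card_subtype,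
    ← smul_eq_mul, ← Finset.sum_const, Finset.sum_filter]
  refine Finset.sum_congr rfl fun i _ => ?_
  by_cases hi : X i
  · rw [if_pos hi]
    refine Finset.sum_congr rfl fun τ _ => ?_
    simp only [Perm.decomposeOption_symm_apply, Perm.coe_mul, Function.comp_apply,
      optionCongr_apply, Option.map_none, Option.map_some, swap_apply_left, hi, if_true]
    refine Finset.prod_congr rfl fun a _ => ?_
    by_cases h : some (τ a) = i
    · rw [h, swap_apply_right, hA a i hi]
    · rw [swap_apply_of_ne_of_ne (by simp) h]
  · simp [hi]

theorem sum_perm_option_option {α : Type*} [Fintype α] [DecidableEq α]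
    (X : Option (Option α) → Prop) [DecidablePred X] (h₀ : X none) (h₁ : X (some none))
    (A : α → Option (Option α) → ℕ) (hA : ∀ a x, X x → A a x = A a none) :
    ∑ σ : Perm (Option (Option α)), ∏ a, A a (σ (some (some a))) =
      ∑ σ : Perm (Option (Option α)), (if X (σ (some none)) then 0 else 1) *
        (if X (σ none) then 2 else 1) * ∏ a, A a (σ (some (some a))) +
      Fintype.card {x // X x} * (Fintype.card {x // X (some x)} *
        ∑ τ : Perm α, ∏ a, A a (some (some (τ a)))) := by
  have key := sum_perm_option X
    (fun a x => a.elim (if X x then 1 else 0) (fun a => A a x)) (by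
      rintro (_ | a) x hx
      · simp [hx, h₀]
      · exact hA a x hx)
  have key' := sum_perm_option (fun x => X (some x)) (fun a x => A a (some x))
    (fun a x hx => by rw [hA _ _ hx, hA _ _ h₁])
  simp only [Fintype.prod_option, Option.elim, ite_mul, one_mul, zero_mul] at key
  rw [← key', ← key]
  have hswap : ∑ σ : Perm (Option (Option α)), (if X (σ (some none)) then 0 else 1) *
        (if X (σ none) then 1 else 0) * ∏ a, A a (σ (some (some a))) =
      ∑ σ : Perm (Option (Option α)), (if X (σ none) then 0 else 1) *
        (if X (σ (some none)) then 1 else 0) * ∏ a, A a (σ (some (some a))) := by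
    refine Fintype.sum_equiv (Equiv.mulRight (swap none (some none))) _ _ fun σ => ?_
    simp only [Equiv.coe_mulRight, Perm.mul_apply, swap_apply_left, swap_apply_right]
    congr 1
  have hsplit : ∀ σ : Perm (Option (Option α)), (if X (σ (some none)) then 0 else 1) *
        (if X (σ none) then 2 else 1) * ∏ a, A a (σ (some (some a))) =
      (if X (σ (some none)) then 0 else 1) * ∏ a, A a (σ (some (some a))) +
      (if X (σ (some none)) then 0 else 1) *
        (if X (σ none) then 1 else 0) * ∏ a, A a (σ (some (some a))) := by
    intro σ
    split_ifs <;> ring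
  simp only [hsplit, Finset.sum_add_distrib]
  rw [hswap, ← Finset.sum_add_distrib, ← Finset.sum_add_distrib]
  refine Finset.sum_congr rfl fun σ _ => ?_
  split_ifs <;> simp

/-- Row `t` of the matrix whose permanent counts tableaux. -/
def tabRow (n t u : ℕ) : ℕ :=
  if 2 * n ≤ t + 1 then 1
  else if t % 2 = 1 then (if u ≤ t then 1 else 0) else (if u < t then 1 else 2)

/-- The bordered permanents attached to tableaux. -/
def tabPerm (n w : ℕ) : ℕ :=
  ∑ σ : Perm (Fin (2 * n + w)), ∏ t : Fin (2 * n + w), tabRow n t (σ t)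

/-- The permutation moving the rows `2n-1, 2n` to the end. -/
def moveRows (n w : ℕ) (hn : 1 ≤ n) : Perm (Fin (2 * n + w + 2)) where
  toFun t := ⟨if t.1 < 2 * n - 1 then t else if t.1 < 2 * n + w then t + 2 else t - (w + 1), by
    split_ifs <;> omega⟩
  invFun t := ⟨if t.1 < 2 * n - 1 then t else if t.1 < 2 * n + 1 then t + (w + 1) else t - 2, by
    split_ifs <;> omega⟩
  left_inv t := by
    ext; dsimp only; split_ifs <;> omega
  right_inv t := by
    ext; dsimp only; split_ifs <;> omega

theorem sum_perm_row_comp {α β : Type*} [Fintype α] [DecidableEq α] [Fintype β] [DecidableEq β]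
    (π : Perm α) (e : α ≃ β) (C : α → α → ℕ) :
    ∑ σ : Perm α, ∏ t, C t (σ t) =
      ∑ σ : Perm β, ∏ x, C (π (e.symm x)) (e.symm (σ x)) := by
  refine Fintype.sum_equiv ((Equiv.mulRight π).trans e.permCongr) _ _ fun σ => ?_
  refine Fintype.prod_equiv (π.symm.trans e) _ _ fun t => ?_
  simp

theorem tabPerm_add_two (n w : ℕ) (hn : 1 ≤ n) :
    tabPerm n (w + 2) = tabPerm (n + 1) w + (w + 2) * ((w + 1) * tabPerm n w) := by
  obtain ⟨e, he₀, he₁, he₂⟩ : ∃ e : Fin (2 * n + w + 2) ≃ Option (Option (Fin (2 * n + w))),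
      (e.symm none).1 = 2 * n + w + 1 ∧ (e.symm (some none)).1 = 2 * n + w ∧
      ∀ a, (e.symm (some (some a))).1 = a.1 :=
    ⟨((optionCongr finSuccEquivLast.symm).trans finSuccEquivLast.symm).symm,
      by simp [-optionCongr_symm], by simp [-optionCongr_symm], by simp [-optionCongr_symm]⟩
  have key := sum_perm_option_option (fun x => 2 * n ≤ (e.symm x).1)
    (by simp only [he₀]; omega) (by simp only [he₁]; omega)
    (fun a x => tabRow n a (e.symm x).1)
    (by
      intro a x hx
      simp only [tabRow, he₀]
      grind)
  have hc : ∀ N k : ℕ, Fintype.card {x : Fin (N + k) // N ≤ x.1} = k := by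
    intro N k
    rw [Fintype.card_subtype]
    have : (Finset.univ.filter fun x : Fin (N + k) => N ≤ x.1) =
        Finset.univ.map (Fin.natAddEmb N) := by
      ext x
      simp only [Finset.mem_filter, Finset.mem_univ, true_and, Finset.mem_map, Fin.natAddEmb_apply]
      constructor
      · intro h
        exact ⟨⟨x - N, by omega⟩, by ext; simp; omega⟩
      · rintro ⟨y, rfl⟩; simp
    rw [this]; simp
  have hc₂ : Fintype.card {x // 2 * n ≤ (e.symm x).1} = w + 2 :=
    (Fintype.card_congr (e.symm.subtypeEquiv (by simp))).trans (hc (2 * n) (w + 2))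
  have hc₁ : Fintype.card {x // 2 * n ≤ (e.symm (some x)).1} = w + 1 := by
    refine (Fintype.card_congr ((finSuccEquivLast (n := 2 * n + w)).symm.subtypeEquiv ?_)).trans
      (hc (2 * n) (w + 1))
    rintro (_ | a)
    · simp [he₁]
    · simp [he₂]
  rw [hc₁, hc₂] at key
  have h₁ : tabPerm n (w + 2) = ∑ σ : Perm (Option (Option (Fin (2 * n + w)))),
      ∏ a : Fin (2 * n + w), tabRow n a (e.symm (σ (some (some a)))).1 := by
    refine (sum_perm_row_comp 1 e (fun t u => tabRow n t u)).trans ?_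
    refine Finset.sum_congr rfl fun σ _ => ?_
    rw [Fintype.prod_option, Fintype.prod_option]
    simp only [Perm.one_apply, he₀, he₁, he₂]
    rw [tabRow, if_pos (by omega), tabRow, if_pos (by omega), one_mul, one_mul]
  have h₂ : tabPerm (n + 1) w = ∑ σ : Perm (Option (Option (Fin (2 * n + w)))),
      (if 2 * n ≤ (e.symm (σ (some none))).1 then 0 else 1) *
        (if 2 * n ≤ (e.symm (σ none)).1 then 2 else 1) *
      ∏ a : Fin (2 * n + w), tabRow n a (e.symm (σ (some (some a)))).1 := by
    have h : 2 * (n + 1) + w = 2 * n + w + 2 := by ring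
    unfold tabPerm
    rw [h]
    refine (sum_perm_row_comp (moveRows n w hn) e (fun t u => tabRow (n + 1) t u)).trans ?_
    refine Finset.sum_congr rfl fun σ _ => ?_
    rw [Fintype.prod_option, Fintype.prod_option, ← mul_assoc, mul_comm (tabRow _ _ _)]
    congr 1
    · simp only [moveRows, Equiv.coe_fn_mk, he₀, he₁]
      simp only [tabRow]
      grind
    · refine Finset.prod_congr rfl fun a _ => ?_
      simp only [moveRows, Equiv.coe_fn_mk, he₂]
      simp only [tabRow]
      grind
  simp only [he₂] at key
  rw [h₁, h₂, key]
  rfl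

theorem tabPerm_one (w : ℕ) : tabPerm 1 w = 2 * (w + 2).factorial := by
  have : ∀ σ : Perm (Fin (2 * 1 + w)), ∏ t : Fin (2 * 1 + w), tabRow 1 t (σ t) = 2 := by
    intro σ
    rw [Fintype.prod_eq_single ⟨0, by omega⟩]
    · simp [tabRow]
    · intro t ht
      have : t.1 ≠ 0 := fun h => ht (Fin.ext h)
      rw [tabRow, if_pos (by omega)]
  rw [tabPerm, Finset.sum_congr rfl fun σ _ => this σ, Finset.sum_const, Finset.card_univ,
    Fintype.card_perm, Fintype.card_fin, smul_eq_mul, mul_comm, add_comm 2 w]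

/-- The row of a tableau corresponding to row `t` of `tabRow n`. -/
def rowOf (n t : ℕ) : ℕ := if t % 2 = 1 then (t + 1) / 2 else 2 * n - t / 2

/-- The set of dots encoded by a choice of columns. -/
def dots (n : ℕ) (c : Fin (2 * n) → Fin n) : Finset (ℕ × ℕ) :=
  Finset.univ.image fun t => ((c t).1 + 1, rowOf n t)

theorem dots_map_injective (n : ℕ) (c : Fin (2 * n) → Fin n) :
    Function.Injective fun t : Fin (2 * n) => ((c t).1 + 1, rowOf n t) := by
  intro t t' h
  simp only [Prod.mk.injEq, rowOf] at h
  ext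
  grind

theorem isTab_dots_iff (n : ℕ) (c : Fin (2 * n) → Fin n) :
    IsTab n (dots n c) ↔ (∀ j, Fintype.card {t // c t = j} = 2) ∧
      ∀ t : Fin (2 * n), (c t).1 + 1 ≤ rowOf n t := by
  have hcol : ∀ j : Fin n, ((dots n c).filter fun d => d.1 = j.1 + 1).card =
      Fintype.card {t // c t = j} := by
    intro j
    rw [dots, Finset.filter_image, Finset.card_image_of_injective _ (dots_map_injective n c),
      Fintype.card_subtype]
    simp [Fin.ext_iff]
  constructor
  · rintro ⟨-, -, h₃, h₄⟩
    refine ⟨fun j => ?_, fun t => ?_⟩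
    · rw [← hcol, h₃ _ (by omega) (by omega)]
    · exact h₄ _ (Finset.mem_image_of_mem _ (Finset.mem_univ t))
  · rintro ⟨h₃, h₄⟩
    refine ⟨?_, ?_, ?_, ?_⟩
    · simp only [dots, Finset.mem_image, Finset.mem_univ, true_and, forall_exists_index,
        forall_apply_eq_imp_iff, rowOf]
      intro t
      have := t.2
      have := (c t).2
      grind
    · intro i hi hi'
      rw [dots, Finset.filter_image, Finset.card_image_of_injective _ (dots_map_injective n c),
        Finset.card_eq_one]
      refine ⟨⟨if i ≤ n then 2 * i - 1 else 2 * (2 * n - i), by split_ifs <;> omega⟩, ?_⟩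
      ext t
      have := t.2
      simp only [Finset.mem_singleton, Fin.ext_iff, rowOf]
      grind
    · intro j hj hj'
      obtain ⟨j, rfl⟩ := Nat.exists_eq_add_of_le' hj
      rw [← h₃ ⟨j, hj'⟩, ← hcol]
    · simp only [dots, Finset.mem_image, Finset.mem_univ, true_and, forall_exists_index,
        forall_apply_eq_imp_iff]
      exact h₄

theorem prod_tabRow (n : ℕ) (c : Fin (2 * n) → Fin n) :
    ∏ t : Fin (2 * n), tabRow n t (2 * (c t).1) =
      if ∀ t : Fin (2 * n), (c t).1 + 1 ≤ rowOf n t then 2 ^ fr n (dots n c) else 0 := by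
  have hrow : ∀ t : Fin (2 * n), tabRow n t (2 * (c t).1) =
      if (c t).1 + 1 ≤ rowOf n t then
        (if 2 * n + 1 ≤ (c t).1 + 1 + rowOf n t then 2 else 1) else 0 := by
    intro t
    have := t.2
    have := (c t).2
    simp only [tabRow, rowOf]
    grind
  simp only [hrow]
  split_ifs with h
  · rw [fr, dots, Finset.filter_image, Finset.card_image_of_injective _ (dots_map_injective n c),
      Finset.card_filter, ← Finset.prod_pow_eq_pow_sum]
    refine Finset.prod_congr rfl fun t _ => ?_
    rw [if_pos (h t)]
    split_ifs <;> rfl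
  · push Not at h
    obtain ⟨t, ht⟩ := h
    exact Finset.prod_eq_zero (Finset.mem_univ t) (if_neg (by omega))

theorem dots_injective (n : ℕ) : Function.Injective (dots n) := by
  intro c c' h
  funext t
  have ht : ((c t).1 + 1, rowOf n t) ∈ dots n c' :=
    h ▸ Finset.mem_image_of_mem _ (Finset.mem_univ t)
  obtain ⟨t', -, h'⟩ := Finset.mem_image.1 ht
  simp only [Prod.mk.injEq, rowOf] at h'
  have : t' = t := by ext; grind
  subst this
  ext; omega

theorem exists_dots_eq {n : ℕ} {T : Finset (ℕ × ℕ)} (hT : IsTab n T) : ∃ c, dots n c = T := by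
  obtain ⟨h₁, h₂, -, -⟩ := hT
  have : ∀ t : Fin (2 * n), ∃ j : Fin n, (j.1 + 1, rowOf n t) ∈ T := by
    intro t
    have := t.2
    obtain ⟨d, hd⟩ := Finset.card_eq_one.1
      (h₂ (rowOf n t) (by simp only [rowOf]; grind) (by simp only [rowOf]; grind))
    have hd : d ∈ T ∧ d.2 = rowOf n t := by
      rw [← Finset.mem_filter (p := fun d : ℕ × ℕ => d.2 = rowOf n t), hd]; simp
    have := h₁ d hd.1
    refine ⟨⟨d.1 - 1, by omega⟩, ?_⟩
    rw [← hd.2]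
    convert hd.1
    simp only
    omega
  choose c hc using this
  refine ⟨c, Finset.eq_of_subset_of_card_le ?_ ?_⟩
  · intro d hd
    obtain ⟨t, -, rfl⟩ := Finset.mem_image.1 hd
    exact hc t
  · rw [dots, Finset.card_image_of_injective _ (dots_map_injective n c), Finset.card_univ,
      Fintype.card_fin]
    rw [Finset.card_eq_sum_card_fiberwise (f := Prod.snd) (t := Finset.Icc 1 (2 * n))]
    · rw [Finset.sum_congr rfl fun i hi => h₂ i (Finset.mem_Icc.1 hi).1 (Finset.mem_Icc.1 hi).2]
      simp
    · intro d hd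
      have := h₁ d hd
      simp; omega

theorem card_perm_comp_eq (n : ℕ) (c : Fin (2 * n) → Fin n) (g : Fin (2 * n) → Fin n)
    (hg : ∀ j, Fintype.card {t // g t = j} = 2) :
    (Finset.univ.filter fun σ : Perm (Fin (2 * n)) => g ∘ σ = c).card =
      if ∀ j, Fintype.card {t // c t = j} = 2 then 2 ^ n else 0 := by
  split_ifs with h
  · obtain ⟨e, rfl⟩ : ∃ e : Perm (Fin (2 * n)), g ∘ e = c :=
      ⟨ofFiberEquiv fun j => Fintype.equivOfCardEq ((h j).trans (hg j).symm),
        funext fun t => ofFiberEquiv_map _ t⟩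
    have := DomMulAct.stabilizer_card g
    rw [Finset.prod_congr rfl fun j _ => by rw [hg j], Finset.prod_const, Finset.card_univ,
      Fintype.card_fin] at this
    rw [← Fintype.card_subtype]
    refine Eq.trans (Fintype.card_congr ?_) this
    refine (Equiv.mulRight e⁻¹).subtypeEquiv fun σ => ?_
    constructor
    · intro h
      funext t
      simpa using congrFun h (e⁻¹ t)
    · intro h
      funext t
      simpa using congrFun h (e t)
  · rw [Finset.card_eq_zero, Finset.filter_eq_empty_iff]
    rintro σ - rfl
    refine h fun j => ?_
    refine Eq.trans (Fintype.card_congr ?_) (hg j)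
    exact (σ.subtypeEquiv fun t => by simp)

theorem finsum_tab (n : ℕ) :
    2 ^ n * ∑ᶠ T ∈ Tab n, 2 ^ fr n T = tabPerm n 0 := by
  classical
  let half : Fin (2 * n) → Fin n := fun u => ⟨u / 2, by omega⟩
  have hhalf : ∀ j, Fintype.card {t // half t = j} = 2 := by
    intro j
    rw [Fintype.card_subtype, Finset.card_eq_two]
    refine ⟨⟨2 * j, by omega⟩, ⟨2 * j + 1, by omega⟩, by simp, ?_⟩
    ext t
    simp only [Finset.mem_filter, Finset.mem_univ, true_and, Finset.mem_insert,
      Finset.mem_singleton, Fin.ext_iff, half]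
    omega
  have hsum : ∑ᶠ T ∈ Tab n, 2 ^ fr n T =
      ∑ c with IsTab n (dots n c), 2 ^ fr n (dots n c) := by
    rw [← finsum_mem_coe_finset]
    refine (finsum_mem_eq_of_bijOn (dots n) ⟨?_, (dots_injective n).injOn, ?_⟩
      fun _ _ => rfl).symm
    · intro c hc
      simpa [Tab] using hc
    · intro T hT
      obtain ⟨c, rfl⟩ := exists_dots_eq hT
      exact ⟨c, by simpa [Tab] using hT, rfl⟩
  have hw : ∀ σ : Perm (Fin (2 * n)), ∏ t : Fin (2 * n), tabRow n t (σ t) =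
      ∏ t : Fin (2 * n), tabRow n t (2 * ((half ∘ σ) t).1) := by
    intro σ
    refine Finset.prod_congr rfl fun t _ => ?_
    have := (σ t).2
    simp only [tabRow, half, Function.comp_apply]
    grind
  rw [hsum]
  change _ = ∑ σ : Perm (Fin (2 * n)), ∏ t : Fin (2 * n), tabRow n t (σ t)
  rw [Finset.sum_congr rfl fun σ _ => hw σ,
    ← Finset.sum_fiberwise Finset.univ (fun σ : Perm (Fin (2 * n)) => half ∘ σ),
    Finset.sum_filter, Finset.mul_sum]
  refine Finset.sum_congr rfl fun c _ => ?_
  rw [Finset.sum_congr rfl fun σ hσ => by rw [(Finset.mem_filter.1 hσ).2], Finset.sum_const,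
    card_perm_comp_eq n c half hhalf, prod_tabRow, isTab_dots_iff]
  split_ifs <;> simp_all

/-- The contribution of the value `v` to the weight of a map `f`: it is `0` if `v` is not
attained, `1` if it is a doubled fixed point, and `2` otherwise. -/
def valueWeight {k : ℕ} (f : Fin k → ℕ) (v : ℕ) : ℕ :=
  if ∃ i, f i = v then
    if (∃ i, i.1 = 2 * v + 1 ∧ f i = v) ∧ ∃ i, i.1 < 2 * v + 1 ∧ f i = v then 1 else 2
  else 0

/-- The weight of a map as a pistol with respect to the values smaller than `m`. -/
def pistolWeight (m : ℕ) {k : ℕ} (f : Fin k → ℕ) : ℕ :=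
  if ∀ i, i.1 / 2 ≤ f i then ∏ v ∈ Finset.range m, valueWeight f v else 0

/-- The weighted sum of the maps from `2m` points to `M` values attaining the first `m` values. -/
def pistolSum (m M : ℕ) : ℕ :=
  ∑ f : Fin (2 * m) → Fin M, pistolWeight m fun i => (f i).1

theorem pistolWeight_congr {m : ℕ} {f g : Fin (2 * m) → ℕ}
    (h : ∀ i, ∀ v < m, f i = v ↔ g i = v) : pistolWeight m f = pistolWeight m g := by
  have h₁ : (∀ i, i.1 / 2 ≤ f i) ↔ ∀ i, i.1 / 2 ≤ g i := by
    refine forall_congr' fun i => ?_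
    have := h i (f i)
    have := h i (g i)
    omega
  simp only [pistolWeight, h₁]
  congr 1
  refine Finset.prod_congr rfl fun v hv => ?_
  simp only [valueWeight, h _ v (Finset.mem_range.1 hv)]

/-- Extension of a map by two further values. -/
def extendTwo {m : ℕ} (f : Fin (2 * m) → ℕ) (a b : ℕ) (i : Fin (2 * (m + 1))) : ℕ :=
  if h : i.1 < 2 * m then f ⟨i, h⟩ else if i.1 = 2 * m then a else b

theorem exists_extendTwo {m : ℕ} (f : Fin (2 * m) → ℕ) (a b : ℕ) (p : ℕ → ℕ → Prop) :
    (∃ i, p i.1 (extendTwo f a b i)) ↔ (∃ i, p i.1 (f i)) ∨ p (2 * m) a ∨ p (2 * m + 1) b := by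
  constructor
  · rintro ⟨i, hi⟩
    unfold extendTwo at hi
    split_ifs at hi with h h'
    · exact Or.inl ⟨⟨i.1, h⟩, hi⟩
    · exact Or.inr (Or.inl (h' ▸ hi))
    · have : i.1 = 2 * m + 1 := by omega
      exact Or.inr (Or.inr (this ▸ hi))
  · rintro (⟨i, hi⟩ | h | h)
    · exact ⟨⟨i, by omega⟩, by simpa [extendTwo] using hi⟩
    · exact ⟨⟨2 * m, by omega⟩, by simpa [extendTwo] using h⟩
    · exact ⟨⟨2 * m + 1, by omega⟩, by simpa [extendTwo] using h⟩

theorem pistolWeight_extendTwo {m : ℕ} (f : Fin (2 * m) → ℕ) (a b : ℕ) :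
    pistolWeight (m + 1) (extendTwo f a b) = pistolWeight m f *
      if m ≤ a ∧ m ≤ b then
        (if b = m then (if a = m ∨ ∃ i, f i = m then 1 else 2)
          else (if a = m ∨ ∃ i, f i = m then 2 else 0))
      else 0 := by
  have h₁ : (∀ i, i.1 / 2 ≤ extendTwo f a b i) ↔ (∀ i, i.1 / 2 ≤ f i) ∧ m ≤ a ∧ m ≤ b := by
    constructor
    · intro h
      refine ⟨fun i => ?_, ?_, ?_⟩
      · simpa [extendTwo] using h ⟨i, by omega⟩
      · simpa [extendTwo] using h ⟨2 * m, by omega⟩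
      · have := h ⟨2 * m + 1, by omega⟩
        simp only [extendTwo] at this
        grind
    · rintro ⟨h, ha, hb⟩ i
      unfold extendTwo
      split_ifs with hi
      · exact h ⟨i, hi⟩
      · omega
      · omega
  simp only [pistolWeight, h₁]
  by_cases hf : ∀ i, i.1 / 2 ≤ f i
  swap
  · simp [hf]
  by_cases hab : m ≤ a ∧ m ≤ b
  swap
  · simp [hab]
  rw [if_pos ⟨hf, hab⟩, if_pos hf, if_pos hab, Finset.prod_range_succ]
  congr 1
  · refine Finset.prod_congr rfl fun v hv => ?_
    have hv := Finset.mem_range.1 hv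
    simp only [valueWeight, exists_extendTwo f a b fun _ y => y = v,
      exists_extendTwo f a b fun i y => i = 2 * v + 1 ∧ y = v,
      exists_extendTwo f a b fun i y => i < 2 * v + 1 ∧ y = v]
    have ha : a ≠ v := by omega
    have hb : b ≠ v := by omega
    simp [ha, hb]
  · simp only [valueWeight, exists_extendTwo f a b fun _ y => y = m,
      exists_extendTwo f a b fun i y => i = 2 * m + 1 ∧ y = m,
      exists_extendTwo f a b fun i y => i < 2 * m + 1 ∧ y = m]
    have h₂ : ¬ ∃ i : Fin (2 * m), i.1 = 2 * m + 1 ∧ f i = m := by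
      rintro ⟨i, hi, -⟩; omega
    have h₃ : (∃ i : Fin (2 * m), i.1 < 2 * m + 1 ∧ f i = m) ↔ ∃ i, f i = m :=
      exists_congr fun i => ⟨And.right, fun h => ⟨by omega, h⟩⟩
    simp only [h₂, h₃]
    grind

theorem sum_fin_eq_add_mul (m x c : ℕ) (F : ℕ → ℕ) (h₀ : ∀ i < m, F i = 0)
    (hc : ∀ i, m < i → F i = c) : ∑ a : Fin (m + x + 1), F a = F m + x * c := by
  rw [Fin.sum_univ_eq_sum_range, add_assoc, Finset.sum_range_add,
    Finset.sum_eq_zero fun i hi => h₀ i (Finset.mem_range.1 hi), Finset.sum_range_succ',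
    Finset.sum_congr rfl fun i _ => hc (m + (i + 1)) (by omega)]
  simp [add_comm]

theorem sum_extendTwo_weight (m x : ℕ) (p : Prop) [Decidable p] :
    ∑ a : Fin (m + x + 1), ∑ b : Fin (m + x + 1), (if m ≤ a.1 ∧ m ≤ b.1 then
        (if b.1 = m then (if a.1 = m ∨ p then 1 else 2)
          else (if a.1 = m ∨ p then 2 else 0))
      else 0) = if p then (x + 1) * (2 * x + 1) else 4 * x + 1 := by
  have hb : ∀ a : ℕ, ∑ b : Fin (m + x + 1), (if m ≤ a ∧ m ≤ b.1 then
        (if b.1 = m then (if a = m ∨ p then 1 else 2)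
          else (if a = m ∨ p then 2 else 0))
      else 0) = if m ≤ a then (if a = m ∨ p then 1 + x * 2 else 2) else 0 := by
    intro a
    by_cases ha : m ≤ a
    · rw [sum_fin_eq_add_mul m x (if a = m ∨ p then 2 else 0) (fun b => if m ≤ a ∧ m ≤ b then
        (if b = m then (if a = m ∨ p then 1 else 2)
          else (if a = m ∨ p then 2 else 0))
      else 0) (by intro i hi; exact if_neg (by omega)) (by intro i hi; grind)]
      grind
    · simp [ha]
  rw [Finset.sum_congr rfl fun (a : Fin (m + x + 1)) _ => hb a,
    sum_fin_eq_add_mul m x (if p then 1 + x * 2 else 2)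
      (fun a => if m ≤ a then (if a = m ∨ p then 1 + x * 2 else 2) else 0)
      (by intro i hi; exact if_neg (by omega)) (by intro i hi; grind)]
  split_ifs <;> simp_all <;> ring

theorem sum_pistolWeight_avoiding (m x : ℕ) :
    ∑ f : Fin (2 * m) → Fin (m + x + 1), (if ¬ ∃ i, (f i).1 = m then
      pistolWeight m fun i => (f i).1 else 0) = pistolSum m (m + x) := by
  let p : Fin (m + x + 1) := ⟨m, by omega⟩
  rw [← Finset.sum_filter, pistolSum]
  symm
  refine Finset.sum_nbij (fun f i => p.succAbove (f i)) ?_ ?_ ?_ ?_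
  · intro f _
    simp only [Finset.mem_filter, Finset.mem_univ, true_and, not_exists]
    intro i hi
    exact p.succAbove_ne (f i) (Fin.ext hi)
  · intro f _ g _ h
    funext i
    exact Fin.succAbove_right_injective (congrFun h i)
  · intro f hf
    simp only [Finset.coe_filter, Finset.mem_univ, true_and, not_exists, Set.mem_ofPred_eq] at hf
    choose g hg using fun i => Fin.exists_succAbove_eq (x := f i) (y := p)
      fun h => hf i (by rw [h])
    exact ⟨g, by simp, funext hg⟩
  · intro f _
    refine pistolWeight_congr fun i v hv => ?_
    simp only [Fin.succAbove, Fin.lt_def, Fin.val_castSucc, p]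
    split_ifs <;> simp <;> omega

theorem pistolSum_succ (m x : ℕ) :
    pistolSum (m + 1) (m + x + 1) + 2 * x ^ 2 * pistolSum m (m + x) =
      (x + 1) * (2 * x + 1) * pistolSum m (m + x + 1) + x * pistolSum m (m + x) := by
  have h : pistolSum (m + 1) (m + x + 1) = ∑ f : Fin (2 * m) → Fin (m + x + 1),
      pistolWeight m (fun i => (f i).1) *
        if ∃ i, (f i).1 = m then (x + 1) * (2 * x + 1) else 4 * x + 1 := by
    let e : (Fin (2 * m) → Fin (m + x + 1)) × Fin (m + x + 1) × Fin (m + x + 1) ≃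
        (Fin (2 * (m + 1)) → Fin (m + x + 1)) :=
      { toFun := fun q i =>
          if h : i.1 < 2 * m then q.1 ⟨i, h⟩ else if i.1 = 2 * m then q.2.1 else q.2.2
        invFun := fun f => (fun i => f ⟨i, by omega⟩, f ⟨2 * m, by omega⟩, f ⟨2 * m + 1, by omega⟩)
        left_inv := by
          rintro ⟨f, a, b⟩
          simp
        right_inv := by
          intro f
          funext i
          dsimp only
          split_ifs with h h'
          · rfl
          · congr 1; ext; exact h'.symm
          · congr 1; ext; simp only; omega }
    have he : ∀ q, (fun i => (e q i).1) = extendTwo (fun i => (q.1 i).1) q.2.1 q.2.2 := by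
      intro q
      funext i
      simp only [e, extendTwo, Equiv.coe_fn_mk]
      split_ifs <;> rfl
    rw [pistolSum, ← e.sum_comp, Fintype.sum_prod_type]
    refine Finset.sum_congr rfl fun f _ => ?_
    rw [← sum_extendTwo_weight m x, Fintype.sum_prod_type, Finset.mul_sum]
    refine Finset.sum_congr rfl fun a _ => ?_
    rw [Finset.mul_sum]
    refine Finset.sum_congr rfl fun b _ => ?_
    rw [he, pistolWeight_extendTwo]
  rw [h, ← sum_pistolWeight_avoiding m x, pistolSum, Finset.mul_sum, Finset.mul_sum,
    Finset.mul_sum, ← Finset.sum_add_distrib, ← Finset.sum_add_distrib]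
  refine Finset.sum_congr rfl fun f _ => ?_
  split_ifs <;> ring

/-- The pistol encoded by a map from `2n` points to `n` values. -/
def pistol (n : ℕ) (c : Fin (2 * n) → Fin n) (j : ℕ) : ℕ :=
  if h : 1 ≤ j ∧ j ≤ 2 * n then 2 * ((c ⟨j - 1, by omega⟩).1 + 1) else 0

theorem pistol_succ {n : ℕ} (c : Fin (2 * n) → Fin n) (i : Fin (2 * n)) :
    pistol n c (i + 1) = 2 * ((c i).1 + 1) := by
  rw [pistol, dif_pos ⟨by omega, by omega⟩]
  rfl

theorem exists_pistol_eq_iff {n : ℕ} (c : Fin (2 * n) → Fin n) (v : ℕ) (p : ℕ → Prop) :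
    (∃ j, p j ∧ pistol n c j = 2 * (v + 1)) ↔ ∃ i, p (i.1 + 1) ∧ (c i).1 = v := by
  constructor
  · rintro ⟨j, hp, hj⟩
    have h : 1 ≤ j ∧ j ≤ 2 * n := by
      by_contra h
      rw [pistol, dif_neg h] at hj
      omega
    obtain ⟨j, rfl⟩ := Nat.exists_eq_add_of_le' h.1
    refine ⟨⟨j, by omega⟩, hp, ?_⟩
    have := pistol_succ c ⟨j, by omega⟩
    simp only at this
    omega
  · rintro ⟨i, hp, hi⟩
    exact ⟨i + 1, hp, by rw [pistol_succ, hi]⟩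

theorem pistol_injective (n : ℕ) : Function.Injective (pistol n) := by
  intro c c' h
  funext i
  have := congrFun h (i + 1)
  rw [pistol_succ, pistol_succ] at this
  ext
  omega

theorem exists_pistol_eq {n : ℕ} {f : ℕ → ℕ} (hf : IsSP n f) : ∃ c, pistol n c = f := by
  obtain ⟨h₁, -, h₃⟩ := hf
  refine ⟨fun i => ⟨f (i + 1) / 2 - 1, ?_⟩, ?_⟩
  · have := h₁ (i + 1) (by omega) (by omega)
    omega
  · funext j
    rw [pistol]
    split_ifs with h
    · obtain ⟨⟨a, ha⟩, h₂, -⟩ := h₁ j h.1 h.2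
      simp only [Nat.sub_add_cancel h.1]
      omega
    · exact (h₃ j (by omega)).symm

theorem isSP_pistol_iff {n : ℕ} (c : Fin (2 * n) → Fin n) :
    IsSP n (pistol n c) ↔ (∀ i, i.1 / 2 ≤ (c i).1) ∧ ∀ v < n, ∃ i, (c i).1 = v := by
  constructor
  · rintro ⟨h₁, h₂, -⟩
    refine ⟨fun i => ?_, fun v hv => ?_⟩
    · have := h₁ (i + 1) (by omega) (by omega)
      rw [pistol_succ] at this
      omega
    · obtain ⟨j, -, -, hj⟩ := h₂ (2 * (v + 1)) (even_two_mul _) (by omega) (by omega)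
      obtain ⟨i, -, hi⟩ := (exists_pistol_eq_iff c v fun _ => True).1 ⟨j, trivial, hj⟩
      exact ⟨i, hi⟩
  · rintro ⟨h₁, h₂⟩
    refine ⟨fun j hj hj' => ?_, fun v hv hv₂ hvn => ?_, fun j hj => dif_neg (by omega)⟩
    · obtain ⟨i, rfl⟩ := Nat.exists_eq_add_of_le' hj
      have h := pistol_succ c ⟨i, by omega⟩
      have := h₁ ⟨i, by omega⟩
      simp only at h this
      rw [h]
      exact ⟨even_two_mul _, by omega, by omega, by omega⟩
    · obtain ⟨a, rfl⟩ := hv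
      obtain ⟨i, hi⟩ := h₂ (a - 1) (by omega)
      exact ⟨i + 1, by omega, by omega, by rw [pistol_succ]; omega⟩

theorem isDFP_pistol_iff {n : ℕ} (c : Fin (2 * n) → Fin n) (v : ℕ) :
    IsDFP (pistol n c) (2 * (v + 1)) ↔
      (∃ i, i.1 = 2 * v + 1 ∧ (c i).1 = v) ∧ ∃ i, i.1 < 2 * v + 1 ∧ (c i).1 = v := by
  have h₁ := exists_pistol_eq_iff c v fun j => j = 2 * (v + 1)
  have h₂ := exists_pistol_eq_iff c v fun j => j < 2 * (v + 1)
  simp only [exists_eq_left] at h₁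
  rw [IsDFP, h₁, h₂]
  simp only [show ∀ i, i + 1 = 2 * (v + 1) ↔ i = 2 * v + 1 by omega,
    show ∀ i, i + 1 < 2 * (v + 1) ↔ i < 2 * v + 1 by omega]

theorem two_pow_ndf_pistol {n : ℕ} (hn : 1 ≤ n) (c : Fin (2 * n) → Fin n)
    (hc : IsSP n (pistol n c)) :
    2 ^ ndf n (pistol n c) = 2 * pistolWeight n fun i => (c i).1 := by
  classical
  obtain ⟨k, rfl⟩ := Nat.exists_eq_add_of_le' hn
  have hndf : ndf (k + 1) (pistol (k + 1) c) = ((Finset.range (k + 1)).filter fun v =>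
      ¬ (v < k ∧ IsDFP (pistol (k + 1) c) (2 * (v + 1)))).card := by
    rw [ndf, ← Finset.card_image_of_injective _ (add_left_injective 1), ← Set.ncard_coe_finset]
    congr 1
    ext i
    simp only [Set.mem_ofPred_eq, Finset.coe_image, Set.mem_image, Finset.coe_filter,
      Finset.mem_range]
    constructor
    · rintro ⟨h₁, h₂, h₃⟩
      refine ⟨i - 1, ⟨by omega, ?_⟩, by omega⟩
      rw [Nat.sub_add_cancel h₁]
      exact fun h => h₃ ⟨by omega, h.2⟩
    · rintro ⟨v, ⟨h₁, h₂⟩, rfl⟩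
      exact ⟨by omega, by omega, fun h => h₂ ⟨by omega, h.2⟩⟩
  rw [hndf, Finset.card_filter, ← Finset.prod_pow_eq_pow_sum, Finset.prod_range_succ]
  rw [isSP_pistol_iff] at hc
  rw [pistolWeight, if_pos hc.1, Finset.prod_range_succ, mul_left_comm]
  congr 1
  · refine Finset.prod_congr rfl fun v hv => ?_
    have hv := Finset.mem_range.1 hv
    have h := isDFP_pistol_iff c v
    rw [valueWeight, if_pos (hc.2 v (by omega))]
    by_cases h' : IsDFP (pistol (k + 1) c) (2 * (v + 1))
    · rw [if_pos (h.1 h')]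
      simp [h', hv]
    · rw [if_neg fun q => h' (h.2 q)]
      simp [h']
  · have h₁ := hc.1 ⟨2 * k + 1, by omega⟩
    have h₂ := hc.1 ⟨2 * k, by omega⟩
    simp only at h₁ h₂
    have hd : (∃ i : Fin (2 * (k + 1)), i.1 = 2 * k + 1 ∧ (c i).1 = k) ∧
        ∃ i : Fin (2 * (k + 1)), i.1 < 2 * k + 1 ∧ (c i).1 = k :=
      ⟨⟨⟨2 * k + 1, by omega⟩, rfl, by omega⟩, ⟨⟨2 * k, by omega⟩, by simp, by omega⟩⟩
    rw [valueWeight, if_pos (hc.2 k (by omega)), if_pos hd]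
    simp

theorem finsum_sp {n : ℕ} (hn : 1 ≤ n) : ∑ᶠ f ∈ SP n, 2 ^ ndf n f = 2 * pistolSum n n := by
  classical
  have hsum : ∑ᶠ f ∈ SP n, 2 ^ ndf n f =
      ∑ c with IsSP n (pistol n c), 2 ^ ndf n (pistol n c) := by
    rw [← finsum_mem_coe_finset]
    refine (finsum_mem_eq_of_bijOn (pistol n) ⟨?_, (pistol_injective n).injOn, ?_⟩
      fun _ _ => rfl).symm
    · intro c hc
      simpa [SP] using hc
    · intro f hf
      obtain ⟨c, rfl⟩ := exists_pistol_eq hf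
      exact ⟨c, by simpa [SP] using hf, rfl⟩
  rw [hsum, Finset.sum_filter, pistolSum, Finset.mul_sum]
  refine Finset.sum_congr rfl fun c _ => ?_
  split_ifs with h
  · exact two_pow_ndf_pistol hn c h
  · rw [isSP_pistol_iff, not_and] at h
    rw [pistolWeight]
    split_ifs with h'
    · have := h h'
      push Not at this
      obtain ⟨v, hv, hv'⟩ := this
      rw [Finset.prod_eq_zero (Finset.mem_range.2 hv), mul_zero]
      exact if_neg (by simpa using hv')
    · rfl

theorem tabPerm_eq_pistolSum (m k : ℕ) :
    tabPerm (m + 1) (2 * k) =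
      2 ^ (m + 1) * ((2 * k + 2).factorial * pistolSum m (m + k + 1)) := by
  induction m generalizing k with
  | zero =>
    have : pistolSum 0 (0 + k + 1) = 1 := by simp [pistolSum, pistolWeight]
    rw [this, zero_add, tabPerm_one]
    ring
  | succ m ih =>
    have h₁ := tabPerm_add_two (m + 1) (2 * k) (by omega)
    have h₂ := pistolSum_succ m (k + 1)
    have h₃ := ih (k + 1)
    have hfac : (2 * (k + 1) + 2).factorial =
        (2 * k + 4) * ((2 * k + 3) * (2 * k + 2).factorial) := by
      rw [show 2 * (k + 1) + 2 = 2 * k + 2 + 1 + 1 by ring, Nat.factorial_succ, Nat.factorial_succ]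
    rw [hfac] at h₃
    rw [show 2 * k + 2 = 2 * (k + 1) by ring, h₃, ih k, ← show 2 * k + 2 = 2 * (k + 1) by ring]
      at h₁
    rw [show m + 1 + k + 1 = m + (k + 1) + 1 by ring]
    rw [← add_assoc m k 1] at *
    zify at h₁ h₂ ⊢
    linear_combination (-1 : ℤ) * h₁ - 2 ^ (m + 2) * ((2 * k + 2).factorial : ℤ) * h₂

/-- For every `n ≥ 1`, `Σ_{T ∈ Tab_n} 2^{fr(T)} = Σ_{f ∈ SP_n} 2^{ndf(f)}`. -/
theorem sum_tab_eq_sum_sp (n : ℕ) (hn : 1 ≤ n) :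
    ∑ᶠ T ∈ Tab n, 2 ^ fr n T = ∑ᶠ f ∈ SP n, 2 ^ ndf n f := by
  have h₁ := finsum_tab n
  rw [finsum_sp hn]
  obtain ⟨m, rfl⟩ := Nat.exists_eq_add_of_le' hn
  have h₂ := tabPerm_eq_pistolSum m 0
  have h₃ := pistolSum_succ m 0
  simp only [mul_zero, add_zero, zero_add] at h₂ h₃
  refine Nat.eq_of_mul_eq_mul_left (pow_pos two_pos (m + 1)) (h₁.trans (h₂.trans ?_))
  simp at h₃
  simp [h₃]
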